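/- arXiv:2106.09767 — 2 statements merged into one kernel-verified Lean document; each statement's English description precedes it below -/
import Mathlib

section
/- Let F = ℝ((X))((Y)) be the field of formal Laurent series in Y over the field ℝ((X)) of formal Laurent series in X over the reals. Let D₁ = (X, −1 / F) and D₂ = (−X, Y / F) be the quaternion algebras over F with structure constants (X, −1) and (−X, Y) respectively, and let D = D₁ ⊗_F D₂. Then D is a division ring, its center is F, and D has dimension 16 as an F-vector space. -/
open scoped Quaternion TensorProduct

/-- The iterated formal Laurent series field `F = ℝ((X))((Y))`. -/
noncomputable def IterLaurent : Type := LaurentSeries (LaurentSeries ℝ)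

noncomputable instance : Field IterLaurent :=
  inferInstanceAs (Field (LaurentSeries (LaurentSeries ℝ)))

/-- The element `X` of `ℝ((X))((Y))`: the variable of the inner Laurent series field,
viewed as a constant of the outer Laurent series field. -/
noncomputable def Xel : IterLaurent :=
  (HahnSeries.C (HahnSeries.single (1 : ℤ) (1 : ℝ)) : LaurentSeries (LaurentSeries ℝ))

/-- The element `Y` of `ℝ((X))((Y))`: the variable of the outer Laurent series field. -/
noncomputable def Yel : IterLaurent :=
  (HahnSeries.single (1 : ℤ) (1 : LaurentSeries ℝ) : LaurentSeries (LaurentSeries ℝ))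


/-- `x = s^m * p` with `p` a power series of constant coefficient `c`. -/
def Lead {K : Type*} [Field K] (m : ℤ) (x : LaurentSeries K) (c : K) : Prop :=
  ∃ p : PowerSeries K, x = HahnSeries.single m 1 * HahnSeries.ofPowerSeries ℤ K p ∧
    PowerSeries.constantCoeff p = c

section Lead
variable {K : Type*} [Field K] {m n : ℤ} {x y : LaurentSeries K} {c d : K}

lemma Lead.add (hx : Lead m x c) (hy : Lead m y d) : Lead m (x + y) (c + d) := by
  obtain ⟨p, rfl, rfl⟩ := hx
  obtain ⟨q, rfl, rfl⟩ := hy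
  exact ⟨p + q, by rw [map_add, mul_add], by simp⟩

lemma Lead.neg (hx : Lead m x c) : Lead m (-x) (-c) := by
  obtain ⟨p, rfl, rfl⟩ := hx
  exact ⟨-p, by rw [map_neg, mul_neg], by simp⟩

lemma Lead.sub (hx : Lead m x c) (hy : Lead m y d) : Lead m (x - y) (c - d) := by
  rw [sub_eq_add_neg, sub_eq_add_neg]; exact hx.add hy.neg

lemma Lead.mul (hx : Lead m x c) (hy : Lead n y d) : Lead (m + n) (x * y) (c * d) := by
  obtain ⟨p, rfl, rfl⟩ := hx
  obtain ⟨q, rfl, rfl⟩ := hy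
  refine ⟨p * q, ?_, by simp⟩
  rw [map_mul, show (HahnSeries.single (m+n) (1:K)) = HahnSeries.single m 1 * HahnSeries.single n 1
    by simp]
  ring

lemma Lead.zero : Lead m (0 : LaurentSeries K) 0 := ⟨0, by simp, by simp⟩

lemma Lead.const : Lead 0 (HahnSeries.C c : LaurentSeries K) c :=
  ⟨PowerSeries.C c, by
    rw [HahnSeries.ofPowerSeries_C]
    rw [show (HahnSeries.single (0:ℤ) (1:K)) = 1 from rfl, one_mul], by simp⟩

lemma Lead.single : Lead m (HahnSeries.single m c : LaurentSeries K) c :=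
  ⟨PowerSeries.C c, by
    rw [HahnSeries.ofPowerSeries_C, HahnSeries.C_apply]; simp, by simp⟩

lemma Lead.sum {ι : Type*} {s : Finset ι} {f : ι → LaurentSeries K} {g : ι → K}
    (h : ∀ i ∈ s, Lead m (f i) (g i)) : Lead m (∑ i ∈ s, f i) (∑ i ∈ s, g i) := by
  classical
  induction s using Finset.induction_on with
  | empty => simpa using Lead.zero
  | insert a s ha ih =>
    rw [Finset.sum_insert ha, Finset.sum_insert ha]
    exact (h a (by simp)).add (ih fun i hi => h i (by simp [hi]))

lemma Lead.lower (hx : Lead m x c) {k : ℤ} (hk : k < m) : Lead k x 0 := by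
  obtain ⟨p, rfl, rfl⟩ := hx
  obtain ⟨j, hj⟩ := Int.eq_ofNat_of_zero_le (sub_nonneg.2 hk.le)
  obtain rfl : m = k + j := by omega
  refine ⟨PowerSeries.X ^ j * p, ?_, ?_⟩
  · rw [map_mul, HahnSeries.ofPowerSeries_X_pow, ← mul_assoc]
    simp
  · have : j ≠ 0 := by omega
    simp [this]

lemma Lead.unique (hx : Lead m x c) (hy : Lead m x d) : c = d := by
  obtain ⟨p, rfl, rfl⟩ := hx
  obtain ⟨q, h, rfl⟩ := hy
  have : (HahnSeries.single m (1:K)) ≠ 0 := by simp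
  rw [HahnSeries.ofPowerSeries_injective (mul_left_cancel₀ this h)]

lemma Lead.unique_index (hx : Lead m x c) (hy : Lead n x d) (hc : c ≠ 0) (hd : d ≠ 0) :
    m = n := by
  rcases lt_trichotomy m n with h | h | h
  · exact absurd (hx.unique (hy.lower h)) hc
  · exact h
  · exact absurd (hy.unique (hx.lower h)) hd

lemma Lead.ne_zero (hx : Lead m x c) (hc : c ≠ 0) : x ≠ 0 := by
  rintro rfl
  exact hc (hx.unique Lead.zero)

lemma Lead.up (hx : Lead m x 0) : ∃ c, Lead (m + 1) x c := by
  obtain ⟨p, rfl, hp⟩ := hx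
  obtain ⟨q, rfl⟩ := PowerSeries.X_dvd_iff.2 hp
  refine ⟨_, q, ?_, rfl⟩
  rw [map_mul, HahnSeries.ofPowerSeries_X, ← mul_assoc]
  simp

lemma Lead.order (x : LaurentSeries K) : Lead x.order x x.leadingCoeff := by
  refine ⟨x.powerSeriesPart, (x.single_order_mul_powerSeriesPart).symm, ?_⟩
  rw [← PowerSeries.coeff_zero_eq_constantCoeff_apply]
  simp [HahnSeries.leadingCoeff_eq]

lemma Lead.exists {ι : Type*} [Fintype ι] (f : ι → LaurentSeries K) (hf : ∃ i, f i ≠ 0) :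
    ∃ (m : ℤ) (g : ι → K), (∀ i, Lead m (f i) (g i)) ∧ ∃ i, g i ≠ 0 := by
  classical
  obtain ⟨i, hi⟩ := hf
  obtain ⟨j, hj, hmin⟩ := Finset.exists_min_image (Finset.univ.filter fun i => f i ≠ 0)
    (fun i => (f i).order) ⟨i, by simpa using hi⟩
  have h : ∀ i, ∃ c, Lead (f j).order (f i) c := by
    intro i
    by_cases h0 : f i = 0
    · exact ⟨0, h0 ▸ Lead.zero⟩
    · rcases (hmin i (by simpa using h0)).lt_or_eq with h | h
      · exact ⟨_, (Lead.order (f i)).lower h⟩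
      · exact ⟨_, h ▸ Lead.order (f i)⟩
  choose g hg using h
  refine ⟨_, g, hg, j, ?_⟩
  rw [(hg j).unique (Lead.order (f j))]
  simpa using hj

end Lead

lemma sumsq_zero {ι : Type*} [Fintype ι] {g : ι → ℝ} (h : ∑ i, g i * g i = 0) (i : ι) : g i = 0 := by
  rw [Finset.sum_eq_zero_iff_of_nonneg (fun i _ => mul_self_nonneg _)] at h
  simpa using h i (Finset.mem_univ i)

lemma inner_aniso {ι : Type*} [Fintype ι] {c : ℝ} (hc : c ≠ 0) (p q : ι → LaurentSeries ℝ)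
    (h : ∑ i, p i * p i = HahnSeries.single (1:ℤ) c * ∑ i, q i * q i) :
    (∀ i, p i = 0) ∧ ∀ i, q i = 0 := by
  by_contra hne
  obtain ⟨m, g, hg, i, hi⟩ := Lead.exists (Sum.elim p q) (by
    by_contra! h0
    exact hne ⟨fun i => h0 (.inl i), fun i => h0 (.inr i)⟩)
  have hp : ∀ i, Lead m (p i) (g (.inl i)) := fun i => hg (.inl i)
  have hq : ∀ i, Lead m (q i) (g (.inr i)) := fun i => hg (.inr i)
  have hP := Lead.sum (s := Finset.univ) fun i _ => (hp i).mul (hp i)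
  have hQ := (Lead.single (m := 1) (c := c)).mul
    (Lead.sum (s := Finset.univ) fun i _ => (hq i).mul (hq i))
  rw [← h] at hQ
  have h0 := hP.unique (hQ.lower (by omega))
  have hp0 := sumsq_zero h0
  have : ∀ i, ∃ c, Lead (m+1) (p i) c := fun i => Lead.up (hp0 i ▸ hp i)
  choose g' hg' using this
  have hP' := Lead.sum (s := Finset.univ) fun i _ => (hg' i).mul (hg' i)
  have h1 := hQ.unique (hP'.lower (by omega))
  have hq0 := sumsq_zero ((mul_eq_zero.1 h1).resolve_left hc)
  rcases i with i | i
  · exact hi (hp0 i)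
  · exact hi (hq0 i)

lemma inner_aniso' {a b : LaurentSeries ℝ}
    (h : a * a + HahnSeries.single (1:ℤ) (1:ℝ) * (b * b) = 0) : a = 0 := by
  refine (inner_aniso (ι := Fin 1) (c := -1) (by norm_num) (fun _ => a) (fun _ => b) ?_).1 0
  simp only [Finset.univ_unique, Finset.sum_singleton]
  rw [HahnSeries.single_neg]
  linear_combination h

/-- The main valuation computation. -/
lemma outer_lead (p q : Fin 4 → LaurentSeries (LaurentSeries ℝ)) (h : ∃ i, p i ≠ 0 ∨ q i ≠ 0)
    (X α β : LaurentSeries (LaurentSeries ℝ))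
    (hX : X = HahnSeries.C (HahnSeries.single (1:ℤ) (1:ℝ)))
    (hα : α = ∑ i, p i * p i - X * ∑ i, q i * q i)
    (hβ : β = 2 * (p 0 * q 2 - q 0 * p 2 + p 1 * q 3 - q 1 * p 3)) :
    ∃ (m : ℤ) (c : LaurentSeries ℝ), c ≠ 0 ∧ Lead (4 * m) (α * α + X * (β * β)) c := by
  obtain ⟨m, g, hg, i, hi⟩ := Lead.exists (Sum.elim p q) (by
    obtain ⟨i, h | h⟩ := h
    exacts [⟨.inl i, h⟩, ⟨.inr i, h⟩])
  have hp : ∀ i, Lead m (p i) (g (.inl i)) := fun i => hg (.inl i)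
  have hq : ∀ i, Lead m (q i) (g (.inr i)) := fun i => hg (.inr i)
  have hP := Lead.sum (s := Finset.univ) fun i _ => (hp i).mul (hp i)
  have hQ := (Lead.const (c := HahnSeries.single (1:ℤ) (1:ℝ))).mul
    (Lead.sum (s := Finset.univ) fun i _ => (hq i).mul (hq i))
  rw [← hX] at hQ
  rw [zero_add] at hQ
  have hA := hP.sub hQ
  rw [← hα] at hA
  have hB0 := ((((hp 0).mul (hq 2)).sub ((hq 0).mul (hp 2))).add ((hp 1).mul (hq 3))).sub
    ((hq 1).mul (hp 3))
  have hB := hB0.add hB0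
  rw [show ∀ z : LaurentSeries (LaurentSeries ℝ), z + z = 2 * z from fun z => by ring, ← hβ] at hB
  have hX' := (Lead.const (c := HahnSeries.single (1:ℤ) (1:ℝ)))
  rw [← hX] at hX'
  have hXB := hX'.mul (hB.mul hB)
  rw [zero_add] at hXB
  have hN := (hA.mul hA).add hXB
  refine ⟨m, _, ?_, by convert hN using 1; ring⟩
  intro h0
  have h1 := inner_aniso' h0
  have h2 := inner_aniso (c := 1) (by norm_num) _ _ (sub_eq_zero.1 h1)
  rcases i with i | i
  · exact hi (h2.1 i)
  · exact hi (h2.2 i)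

section Alg
variable {F : Type*} [Field F] {X Y : F}

/-- real part of the reduced norm of `a + b κ` -/
def nA (a b : ℍ[F, X, -1]) : F :=
  (a.re * a.re + a.imJ * a.imJ + (X * b.imI) * (X * b.imI) + (X * b.imK) * (X * b.imK))
    - X * (a.imI * a.imI + a.imK * a.imK + b.re * b.re + b.imJ * b.imJ)
/-- `κ`-part of the reduced norm of `a + b κ` -/
def nB (a b : ℍ[F, X, -1]) : F :=
  2 * (a.re * b.re - a.imI * (X * b.imI) + a.imJ * b.imJ - a.imK * (X * b.imK))
/-- reduced norm down to `F` -/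
def nN (a b : ℍ[F, X, -1]) : F := nA a b * nA a b + X * (nB a b * nB a b)

lemma inv1 (a b : ℍ[F, X, -1]) :
    a * (nA a b • star a + (X * nB a b) • star b) - X • (b * (nA a b • star b - nB a b • star a))
     = nN a b • 1 := by
  ext <;> simp [nN, nA, nB] <;> ring

lemma inv2 (a b : ℍ[F, X, -1]) :
    a * (nA a b • star b - nB a b • star a) + b * (nA a b • star a + (X * nB a b) • star b) = 0 := by
  ext <;> simp [nA, nB] <;> ring

lemma nN_of_eq (a b : ℍ[F, X, -1]) (h1 : a * a + X • (b * b) = Y • 1) (h2 : b * a - a * b = 0) :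
    nN a b = Y * Y := by
  have e1 := congrArg QuaternionAlgebra.re h1
  have e2 := congrArg QuaternionAlgebra.imI h1
  have e3 := congrArg QuaternionAlgebra.imJ h1
  have e4 := congrArg QuaternionAlgebra.imK h1
  have e5 := congrArg QuaternionAlgebra.imI h2
  have e6 := congrArg QuaternionAlgebra.imJ h2
  have e7 := congrArg QuaternionAlgebra.imK h2
  simp at e1 e2 e3 e4 e5 e6 e7
  simp only [nN, nA, nB]
  grind

lemma isCentral_quat (u v : F) (hu : u ≠ 0) (h2 : (2:F) ≠ 0) :
    Subalgebra.center F ℍ[F, u, v] = ⊥ := by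
  rw [eq_bot_iff]
  intro z hz
  rw [Subalgebra.mem_center_iff] at hz
  have hi := hz ⟨0, 1, 0, 0⟩
  have hj := hz ⟨0, 0, 1, 0⟩
  have e1 := congrArg QuaternionAlgebra.imJ hi
  have e2 := congrArg QuaternionAlgebra.imK hi
  have e3 := congrArg QuaternionAlgebra.imK hj
  simp at e1 e2 e3
  rw [Algebra.mem_bot]
  refine ⟨z.re, ?_⟩
  ext <;> simp <;> grind

lemma center_tensor (A B : Type*) [Ring A] [Ring B] [Algebra F A] [Algebra F B]
    [Nontrivial A] [Nontrivial B]
    (hA : Subalgebra.center F A = ⊥) (hB : Subalgebra.center F B = ⊥) :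
    Subalgebra.center F (A ⊗[F] B) = ⊥ := by
  rw [eq_bot_iff]
  intro z hz
  have h1 : z ∈ Subalgebra.centralizer F
      ((Algebra.TensorProduct.includeLeft : A →ₐ[F] A ⊗[F] B).range : Set (A ⊗[F] B)) := by
    rw [Subalgebra.mem_centralizer_iff]
    intro g _
    exact (Subalgebra.mem_center_iff.1 hz g)
  rw [Subalgebra.centralizer_coe_range_includeLeft_eq_center_tensorProduct] at h1
  obtain ⟨w, rfl⟩ := h1
  have h2 : ∃ y : B, (Algebra.TensorProduct.map (Subalgebra.center F A).val (AlgHom.id F B)) w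
      = 1 ⊗ₜ y := by
    clear hz
    induction w using TensorProduct.induction_on with
    | zero => exact ⟨0, by simp⟩
    | add x y hx hy =>
      obtain ⟨x', hx⟩ := hx
      obtain ⟨y', hy⟩ := hy
      exact ⟨x' + y', by rw [map_add, hx, hy, TensorProduct.tmul_add]⟩
    | tmul a b =>
      obtain ⟨a, ha⟩ := a
      have ha' := ha
      rw [hA, Algebra.mem_bot] at ha'
      obtain ⟨r, rfl⟩ := ha'
      refine ⟨r • b, ?_⟩
      simp [Algebra.algebraMap_eq_smul_one, TensorProduct.smul_tmul]
  obtain ⟨y, hy⟩ := h2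
  change (Algebra.TensorProduct.map (Subalgebra.center F A).val (AlgHom.id F B)) w ∈ _ at hz
  change (Algebra.TensorProduct.map (Subalgebra.center F A).val (AlgHom.id F B)) w ∈ _
  rw [hy] at hz ⊢
  have h3 : y ∈ Subalgebra.center F B := by
    rw [Subalgebra.mem_center_iff] at hz ⊢
    intro b
    have := hz (1 ⊗ₜ b)
    simp only [Algebra.TensorProduct.tmul_mul_tmul, mul_one] at this
    exact Algebra.TensorProduct.includeRight_injective
      (FaithfulSMul.algebraMap_injective F A) this
  rw [hB, Algebra.mem_bot] at h3
  obtain ⟨r, rfl⟩ := h3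
  rw [Algebra.mem_bot]
  refine ⟨r, ?_⟩
  simp [Algebra.algebraMap_eq_smul_one, Algebra.TensorProduct.one_def]

/-- `a + b κ` -/
def ee (a b : ℍ[F, X, -1]) : ℍ[F, X, -1] ⊗[F] ℍ[F, -X, Y] :=
  a ⊗ₜ 1 + b ⊗ₜ ⟨0, 1, 0, 0⟩
/-- `λ` -/
def ll : ℍ[F, X, -1] ⊗[F] ℍ[F, -X, Y] := 1 ⊗ₜ ⟨0, 0, 1, 0⟩

lemma ii_mul : (⟨0,1,0,0⟩ : ℍ[F, -X, Y]) * ⟨0,1,0,0⟩ = (-X) • 1 := by ext <;> simp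
lemma jj_mul : (⟨0,0,1,0⟩ : ℍ[F, -X, Y]) * ⟨0,0,1,0⟩ = Y • 1 := by ext <;> simp
lemma ij_mul : (⟨0,1,0,0⟩ : ℍ[F, -X, Y]) * ⟨0,0,1,0⟩ = ⟨0,0,0,1⟩ := by ext <;> simp
lemma ji_mul : (⟨0,0,1,0⟩ : ℍ[F, -X, Y]) * ⟨0,1,0,0⟩ = -⟨0,0,0,1⟩ := by ext <;> simp

lemma ee_mul (a b c d : ℍ[F, X, -1]) :
    (ee a b * ee c d : ℍ[F, X, -1] ⊗[F] ℍ[F, -X, Y]) = ee (a * c - X • (b * d)) (a * d + b * c) := by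
  simp only [ee, mul_add, add_mul, Algebra.TensorProduct.tmul_mul_tmul, mul_one, one_mul, ii_mul,
    TensorProduct.sub_tmul, TensorProduct.add_tmul, TensorProduct.tmul_smul, TensorProduct.smul_tmul',
    neg_smul, TensorProduct.tmul_neg]
  abel

lemma ee_add (a b c d : ℍ[F, X, -1]) :
    (ee a b + ee c d : ℍ[F, X, -1] ⊗[F] ℍ[F, -X, Y]) = ee (a + c) (b + d) := by
  simp only [ee, TensorProduct.add_tmul]
  abel

lemma ll_mul_ee (a b : ℍ[F, X, -1]) :
    (ll * ee a b : ℍ[F, X, -1] ⊗[F] ℍ[F, -X, Y]) = ee a (-b) * ll := by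
  simp only [ee, ll, mul_add, add_mul, Algebra.TensorProduct.tmul_mul_tmul, mul_one, one_mul,
    ij_mul, ji_mul]
  simp only [TensorProduct.neg_tmul, TensorProduct.tmul_neg]

lemma ll_mul_ll : (ll * ll : ℍ[F, X, -1] ⊗[F] ℍ[F, -X, Y]) = ee (Y • 1) 0 := by
  simp only [ll, ee, Algebra.TensorProduct.tmul_mul_tmul, mul_one, jj_mul, TensorProduct.tmul_smul,
    TensorProduct.smul_tmul', TensorProduct.zero_tmul, add_zero]

lemma ee_one : (ee 1 0 : ℍ[F, X, -1] ⊗[F] ℍ[F, -X, Y]) = 1 := by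
  simp [ee, Algebra.TensorProduct.one_def]

lemma ee_zero : (ee 0 0 : ℍ[F, X, -1] ⊗[F] ℍ[F, -X, Y]) = 0 := by
  simp [ee]

lemma exists_rep (x : ℍ[F, X, -1] ⊗[F] ℍ[F, -X, Y]) :
    ∃ a b c d : ℍ[F, X, -1], x = ee a b + ll * ee c d := by
  induction x using TensorProduct.induction_on with
  | zero => exact ⟨0, 0, 0, 0, by simp [ee_zero]⟩
  | add x y hx hy =>
    obtain ⟨a, b, c, d, rfl⟩ := hx
    obtain ⟨a', b', c', d', rfl⟩ := hy
    refine ⟨a + a', b + b', c + c', d + d', ?_⟩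
    rw [← ee_add, ← ee_add, mul_add]
    abel
  | tmul u v =>
    refine ⟨v.re • u, v.imI • u, v.imJ • u, -(v.imK • u), ?_⟩
    have : v = v.re • 1 + v.imI • ⟨0,1,0,0⟩ + v.imJ • ⟨0,0,1,0⟩ + v.imK • ⟨0,0,0,1⟩ := by
      ext <;> simp
    conv_lhs => rw [this]
    simp only [ee, ll, mul_add, Algebra.TensorProduct.tmul_mul_tmul, mul_one, one_mul, ji_mul]
    simp only [TensorProduct.tmul_add, TensorProduct.tmul_smul, TensorProduct.smul_tmul',
      TensorProduct.neg_tmul, TensorProduct.tmul_neg, neg_neg]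
    abel

lemma ee_rinv (hN : ∀ a b : ℍ[F, X, -1], nN a b = 0 → a = 0 ∧ b = 0) (a b : ℍ[F, X, -1])
    (h : ¬ (a = 0 ∧ b = 0)) :
    ∃ c d, (ee a b * ee c d : ℍ[F, X, -1] ⊗[F] ℍ[F, -X, Y]) = 1 := by
  have h0 : nN a b ≠ 0 := fun h' => h (hN a b h')
  refine ⟨(nN a b)⁻¹ • (nA a b • star a + (X * nB a b) • star b),
    (nN a b)⁻¹ • (nA a b • star b - nB a b • star a), ?_⟩
  rw [ee_mul, mul_smul_comm, mul_smul_comm, mul_smul_comm, mul_smul_comm, smul_comm X, ← smul_sub,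
    ← smul_add, inv1, inv2, smul_zero, smul_smul, inv_mul_cancel₀ h0, one_smul, ee_one]

lemma rinv (hN : ∀ a b : ℍ[F, X, -1], nN a b = 0 → a = 0 ∧ b = 0)
    (hY : ∀ a b : ℍ[F, X, -1], nN a b ≠ Y * Y) (x : ℍ[F, X, -1] ⊗[F] ℍ[F, -X, Y]) (hx : x ≠ 0) :
    ∃ y, x * y = 1 := by
  obtain ⟨a, b, c, d, rfl⟩ := exists_rep x
  by_cases h : c = 0 ∧ d = 0
  · obtain ⟨rfl, rfl⟩ := h
    rw [ee_zero, mul_zero, add_zero] at hx ⊢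
    obtain ⟨c, d, h⟩ := ee_rinv (Y := Y) hN a b (by
      rintro ⟨rfl, rfl⟩
      exact hx ee_zero)
    exact ⟨_, h⟩
  · obtain ⟨c', d', h1⟩ := ee_rinv (Y := Y) hN c d h
    have h2 : (ee a b + ll * ee c d : ℍ[F, X, -1] ⊗[F] ℍ[F, -X, Y]) * ee c' d'
      = ee (a * c' - X • (b * d')) (a * d' + b * c') + ll := by
      rw [add_mul, mul_assoc, h1, mul_one, ee_mul]
    generalize a * c' - X • (b * d') = s at h2
    generalize a * d' + b * c' = t at h2
    have h3 : (ee s t + ll : ℍ[F, X, -1] ⊗[F] ℍ[F, -X, Y]) * (ee s (-t) - ll)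
        = ee (s * s + X • (t * t) - Y • 1) (t * s - s * t) := by
      rw [add_mul, mul_sub, mul_sub, ll_mul_ee, ll_mul_ll, ee_mul, neg_neg, sub_add_sub_cancel,
        sub_eq_iff_eq_add, ee_add]
      congr 1
      · simp
      · simp only [mul_neg]; abel
    obtain ⟨u, v, h4⟩ := ee_rinv (Y := Y) hN (s * s + X • (t * t) - Y • 1) (t * s - s * t) (by
      rintro ⟨e1, e2⟩
      exact hY s t (nN_of_eq s t (sub_eq_zero.1 e1) e2))
    refine ⟨ee c' d' * ((ee s (-t) - ll) * ee u v), ?_⟩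
    rw [← mul_assoc, h2, ← mul_assoc, h3, h4]

lemma isUnit_of_rinv {R : Type*} [Ring R] (h : ∀ x : R, x ≠ 0 → ∃ y, x * y = 1) (x : R)
    (hx : x ≠ 0) : IsUnit x := by
  obtain ⟨y, hy⟩ := h x hx
  obtain ⟨z, hz⟩ := h y (by
    rintro rfl
    rw [mul_zero] at hy
    exact hx (by rw [← mul_one x, ← hy, mul_zero]))
  have : x = z := by
    rw [← mul_one x, ← hz, ← mul_assoc, hy, one_mul]
  exact ⟨⟨x, y, hy, this ▸ hz⟩, rfl⟩

end Alg

lemma Xel_ne : Xel ≠ 0 := by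
  intro h
  have h' : (HahnSeries.C (HahnSeries.single (1 : ℤ) (1 : ℝ)) : LaurentSeries (LaurentSeries ℝ)) = 0 := h
  exact (Lead.const (c := HahnSeries.single (1 : ℤ) (1 : ℝ))).ne_zero (by simp) h'

lemma two_ne : (2 : IterLaurent) ≠ 0 := by
  have : (2 : LaurentSeries (LaurentSeries ℝ)) ≠ 0 := by
    have h := (Lead.const (c := (2 : LaurentSeries ℝ)))
    rw [map_ofNat] at h
    refine h.ne_zero ?_
    have h := (Lead.const (c := (2 : ℝ)))
    rw [map_ofNat] at h
    exact h.ne_zero two_ne_zero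
  exact this

lemma nN_lead (a b : ℍ[IterLaurent, Xel, -1]) (h : ¬ (a = 0 ∧ b = 0)) :
    ∃ (m : ℤ) (c : LaurentSeries ℝ), c ≠ 0 ∧ Lead (4 * m) (nN a b : IterLaurent) c := by
  refine outer_lead ![a.re, a.imJ, Xel * b.imI, Xel * b.imK] ![a.imI, a.imK, b.re, b.imJ] ?_
    Xel (nA a b) (nB a b) rfl ?_ ?_
  · by_contra! h0
    have hX : Xel ≠ 0 := Xel_ne
    have h1 := h0 0
    have h2 := h0 1
    have h3 := h0 2
    have h4 := h0 3
    refine h ⟨?_, ?_⟩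
    · exact QuaternionAlgebra.ext h1.1 h1.2 h2.1 h2.2
    · exact QuaternionAlgebra.ext h3.2 ((mul_eq_zero.1 h3.1).resolve_left hX) h4.2
        ((mul_eq_zero.1 h4.1).resolve_left hX)
  · rw [Fin.sum_univ_four, Fin.sum_univ_four]
    rfl
  · change (2 * (a.re * b.re - a.imI * (Xel * b.imI) + a.imJ * b.imJ - a.imK * (Xel * b.imK)) :
      IterLaurent) = _
    rfl

lemma nN_zero (a b : ℍ[IterLaurent, Xel, -1]) (h : nN a b = 0) : a = 0 ∧ b = 0 := by
  by_contra h0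
  obtain ⟨m, c, hc, hl⟩ := nN_lead a b h0
  exact hl.ne_zero hc h

lemma YY_lead : Lead 2 (Yel * Yel : IterLaurent) (1 : LaurentSeries ℝ) := by
  have h := (Lead.single (m := 1) (c := (1 : LaurentSeries ℝ)))
  have h2 := h.mul h
  rw [mul_one] at h2
  exact h2

lemma nN_ne (a b : ℍ[IterLaurent, Xel, -1]) : nN a b ≠ Yel * Yel := by
  intro h
  have hY := YY_lead
  have h0 : ¬ (a = 0 ∧ b = 0) := by
    rintro ⟨rfl, rfl⟩
    refine hY.ne_zero one_ne_zero (h.symm.trans ?_)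
    simp [nN, nA, nB]
    rfl
  obtain ⟨m, c, hc, hl⟩ := nN_lead a b h0
  rw [h] at hl
  have := hl.unique_index hY hc one_ne_zero
  omega

/-- The biquaternion algebra `D = (X, -1 / F) ⊗_F (-X, Y / F)` over `F = ℝ((X))((Y))`
is a division ring, its center is (the image of) `F`, and it has dimension `16` over `F`. -/
theorem biquaternion_division_central_dim16 :
    (∀ x : ℍ[IterLaurent, Xel, -1] ⊗[IterLaurent] ℍ[IterLaurent, -Xel, Yel],
        x ≠ 0 → IsUnit x) ∧
    Subalgebra.center IterLaurent
        (ℍ[IterLaurent, Xel, -1] ⊗[IterLaurent] ℍ[IterLaurent, -Xel, Yel]) = ⊥ ∧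
    Module.finrank IterLaurent
        (ℍ[IterLaurent, Xel, -1] ⊗[IterLaurent] ℍ[IterLaurent, -Xel, Yel]) = 16 := by
  refine ⟨isUnit_of_rinv (rinv nN_zero nN_ne), ?_, ?_⟩
  · exact center_tensor _ _ (isCentral_quat _ _ Xel_ne two_ne)
      (isCentral_quat _ _ (neg_ne_zero.2 Xel_ne) two_ne)
  · rw [Module.finrank_tensorProduct, QuaternionAlgebra.finrank_eq_four,
      QuaternionAlgebra.finrank_eq_four]
end

section
/- Let p be a prime and q a prime with q ≠ p, and let k₀ be a field of characteristic p containing a primitive q-th root of unity. Let Γ be the additive subgroup of ℚ generated by { 1/pⁿ : n ∈ ℕ }. Let k = k₀((x^Γ)) be the field of Hahn series over k₀ with value group Γ (with variable x), and F = k((t^Γ)) the field of Hahn series over k with value group Γ (with variable t). Let K = F(u) be the extension obtained by adjoining u with u^q = t (a cyclic extension of F of degree q). Then the element x (the Hahn series x¹ of k, viewed inside F) is not a norm from K: x ∉ N_{K/F}(K). -/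
/-- The additive subgroup `Γ = ⟨1/pⁿ : n ∈ ℕ⟩` of `ℚ`. -/
def GammaP (p : ℕ) : AddSubgroup ℚ :=
  AddSubgroup.closure {x : ℚ | ∃ n : ℕ, x = 1 / (p : ℚ) ^ n}

/-- The element `1` of `Γ = ⟨1/pⁿ : n ∈ ℕ⟩` (it is the generator `1/p⁰`). -/
def oneGammaP (p : ℕ) : GammaP p :=
  ⟨1, AddSubgroup.subset_closure ⟨0, by norm_num⟩⟩

open Polynomial in
lemma norm_core.{a, b, c} {F : Type a} {K : Type b} {L : Type c} [Field F] [Field K] [Field L] [Algebra F K] (ι : F →+* L)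
    (q : ℕ) (hq : q.Prime) (a : F) (ha : ∀ b : F, b ^ q ≠ a) (ζ : F) (hζ : IsPrimitiveRoot ζ q)
    (u : K) (hu : u ^ q = algebraMap F K a) (hadj : Algebra.adjoin F {u} = ⊤)
    (w : L) (hw : w ^ q = ι a) (y : K) :
    ∃ (P : F[X]) (I : Type (max b c)) (_ : Fintype I) (e : I → ℕ), Fintype.card I = q ∧
      ι (Algebra.norm F y) =
        ∏ s : I, ∑ j ∈ Finset.range q, ι (P.coeff j) * (ι ζ ^ e s * w) ^ j := by
  have hirr : Irreducible (X ^ q - C a) := X_pow_sub_C_irreducible_of_prime hq ha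
  have hmonic : (X ^ q - C a).Monic := monic_X_pow_sub_C a hq.ne_zero
  have hmin : minpoly F u = X ^ q - C a :=
    (minpoly.eq_of_irreducible_of_monic hirr (by simp [hu]) hmonic).symm
  have hint : IsIntegral F u := ⟨_, hmonic, by simp [hu]⟩
  have htop : IntermediateField.adjoin F {u} = ⊤ :=
    IntermediateField.adjoin_eq_top_of_algebra F _ hadj
  have hsepu : IsSeparable F u := by
    rw [IsSeparable, hmin]
    exact separable_X_pow_sub_C_of_irreducible
      ⟨ζ, (mem_primitiveRoots hq.pos).2 hζ⟩ a hirr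
  have hsep : Algebra.IsSeparable F K := by
    have := (IntermediateField.isSeparable_adjoin_simple_iff_isSeparable (F := F) (E := K)).2 hsepu
    rw [htop] at this
    exact Algebra.IsSeparable.of_algHom F _ (IntermediateField.topEquiv (F := F) (E := K)).symm.toAlgHom
  have hfd : FiniteDimensional F K := by
    have := IntermediateField.adjoin.finiteDimensional hint
    rw [htop] at this
    exact LinearEquiv.finiteDimensional (IntermediateField.topEquiv (F := F) (E := K)).toLinearEquiv
  have hrank : Module.finrank F K = q := by
    have := IntermediateField.adjoin.finrank hint
    rw [htop, IntermediateField.finrank_top', hmin, natDegree_X_pow_sub_C] at this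
    exact this
  let E := AlgebraicClosure L
  let _ : Algebra F E := ((algebraMap L E).comp ι).toAlgebra
  have hFE : ∀ c, algebraMap F E c = algebraMap L E (ι c) := fun c => rfl
  -- polynomial representation
  obtain ⟨Q, hQ⟩ : ∃ Q : F[X], aeval u Q = y := by
    have : y ∈ Algebra.adjoin F {u} := by rw [hadj]; trivial
    rwa [Algebra.adjoin_singleton_eq_range_aeval] at this
  let P := Q %ₘ (X ^ q - C a)
  have hP : aeval u P = y := by
    rw [← hQ]
    have : P = Q %ₘ minpoly F u := by rw [hmin]
    rw [this]
    exact aeval_modByMonic_eq_self_of_root (minpoly.aeval _ _)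
  have hPd : P.natDegree < q := by
    have := natDegree_modByMonic_lt Q hmonic (by
      intro h
      have := congrArg natDegree h
      rw [natDegree_X_pow_sub_C] at this
      simp [hq.ne_zero] at this)
    rwa [natDegree_X_pow_sub_C] at this
  have hz : IsPrimitiveRoot (algebraMap F E ζ) q := hζ.map_of_injective (algebraMap F E).injective
  have hex : ∀ σ : K →ₐ[F] E, ∃ i : ℕ, σ u = algebraMap L E (ι ζ ^ i * w) := by
    intro σ
    have h1 : (σ u) ^ q = (algebraMap L E w) ^ q := by
      rw [← map_pow, hu, σ.commutes, ← map_pow, hw, hFE]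
    by_cases h0 : algebraMap L E w = 0
    · refine ⟨0, ?_⟩
      rw [h0, zero_pow hq.ne_zero] at h1
      simp [h0, eq_zero_of_pow_eq_zero h1]
    · have : (σ u / algebraMap L E w) ^ q = 1 := by
        rw [div_pow, h1, div_self (pow_ne_zero _ h0)]
      have : NeZero q := ⟨hq.ne_zero⟩
      obtain ⟨i, -, hi⟩ := hz.eq_pow_of_pow_eq_one ‹_›
      refine ⟨i, ?_⟩
      rw [map_mul, map_pow, ← hFE, hi, div_mul_cancel₀ _ h0]
  choose e he using hex
  refine ⟨P, K →ₐ[F] E, inferInstance, e, ?_, ?_⟩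
  · rw [AlgHom.card, hrank]
  · apply (algebraMap L E).injective
    rw [← hFE, Algebra.norm_eq_prod_embeddings F E y, map_prod]
    refine Finset.prod_congr rfl fun σ _ => ?_
    rw [← hP, ← aeval_algHom_apply, aeval_eq_sum_range' hPd, map_sum]
    refine Finset.sum_congr rfl fun j _ => ?_
    rw [he, Algebra.smul_def, hFE, map_mul (algebraMap L E) (ι (P.coeff j)), map_pow (algebraMap L E) _ j]

lemma GammaP_form (p : ℕ) (hp : p.Prime) (g : ℚ) (hg : g ∈ GammaP p) :
    ∃ (m : ℤ) (n : ℕ), g * (p : ℚ) ^ n = m := by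
  have hp0 : (p : ℚ) ≠ 0 := by exact_mod_cast hp.ne_zero
  induction hg using AddSubgroup.closure_induction with
  | mem x hx =>
    obtain ⟨n, rfl⟩ := hx
    exact ⟨1, n, by simp [hp0]⟩
  | zero => exact ⟨0, 0, by simp⟩
  | add x y _ _ hx hy =>
    obtain ⟨m, n, h⟩ := hx
    obtain ⟨m', n', h'⟩ := hy
    refine ⟨m * p ^ n' + m' * p ^ n, n + n', ?_⟩
    push_cast
    rw [← h, ← h']; ring
  | neg x _ hx =>
    obtain ⟨m, n, h⟩ := hx
    exact ⟨-m, n, by push_cast; rw [← h]; ring⟩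

lemma GammaP_dvd (p q : ℕ) (hp : p.Prime) (hq : q.Prime) (hqp : q ≠ p) (g : ℚ)
    (hg : g ∈ GammaP p) (d : ℤ) (h : q * g = d) : (q : ℤ) ∣ d := by
  obtain ⟨m, n, hm⟩ := GammaP_form p hp g hg
  have h1 : (q : ℤ) * m = d * (p : ℤ) ^ n := by
    have : (q : ℚ) * m = d * (p : ℚ) ^ n := by rw [← hm, ← h]; ring
    exact_mod_cast this
  have h2 : IsCoprime (q : ℤ) ((p : ℤ) ^ n) := by
    apply IsCoprime.pow_right
    rw [Nat.isCoprime_iff_coprime]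
    exact (Nat.coprime_primes hq hp).2 hqp
  exact h2.dvd_of_dvd_mul_right ⟨m, h1.symm⟩

lemma one_not_mul (p q : ℕ) (hp : p.Prime) (hq : q.Prime) (hqp : q ≠ p) (g : GammaP p) :
    q • g ≠ oneGammaP p := by
  intro h
  have h' : (q : ℚ) * (g : ℚ) = ((1 : ℤ) : ℚ) := by
    have := congrArg (Subtype.val) h
    simpa [oneGammaP] using this
  have := GammaP_dvd p q hp hq hqp g g.2 1 h'
  have h2 := Int.natCast_dvd_natCast.1 (by exact_mod_cast this : (q : ℤ) ∣ ((1 : ℕ) : ℤ))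
  exact hq.one_lt.ne' (Nat.dvd_one.1 h2)

lemma lt_orderTop_sum {G R ι : Type*} [LinearOrder G] [AddCommMonoid R] (S : Finset ι)
    (f : ι → HahnSeries G R) (g : G) (h : ∀ i ∈ S, (g : WithTop G) < (f i).orderTop) :
    (g : WithTop G) < (∑ i ∈ S, f i).orderTop := by
  classical
  induction S using Finset.induction_on with
  | empty => simp
  | insert i S hi ih =>
    rw [Finset.sum_insert hi]
    exact lt_of_lt_of_le (lt_min (h i (by simp)) (ih fun j hj => h j (by simp [hj])))
      HahnSeries.min_orderTop_le_orderTop_add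

lemma leadingCoeff_sum_dominant {G R ι : Type*} [LinearOrder G] [AddCommMonoid R] (S : Finset ι)
    (f : ι → HahnSeries G R) (j : ι) (hj : j ∈ S) (h0 : f j ≠ 0)
    (h : ∀ i ∈ S, i ≠ j → (f j).orderTop < (f i).orderTop) :
    (∑ i ∈ S, f i).leadingCoeff = (f j).leadingCoeff := by
  classical
  rw [← Finset.add_sum_erase _ _ hj]
  apply HahnSeries.leadingCoeff_add_eq_left
  have ht : (f j).orderTop ≠ ⊤ := HahnSeries.orderTop_ne_top.2 h0
  obtain ⟨g, hg⟩ := WithTop.ne_top_iff_exists.1 ht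
  rw [← hg]
  apply lt_orderTop_sum
  intro i hi
  rw [hg]
  exact h i (Finset.mem_of_mem_erase hi) (Finset.ne_of_mem_erase hi)

lemma leadingCoeff_prod {G R ι : Type*} [AddCommGroup G] [LinearOrder G] [IsOrderedAddMonoid G]
    [Field R] (S : Finset ι) (f : ι → HahnSeries G R) :
    (∏ i ∈ S, f i).leadingCoeff = ∏ i ∈ S, (f i).leadingCoeff := by
  classical
  induction S using Finset.induction_on with
  | empty => simp
  | insert i S hi ih =>
    rw [Finset.prod_insert hi, Finset.prod_insert hi, HahnSeries.leadingCoeff_mul, ih]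

lemma order_prod_const {G R ι : Type*} [AddCommGroup G] [LinearOrder G] [IsOrderedAddMonoid G]
    [Field R] (S : Finset ι) (f : ι → HahnSeries G R) (g : G) (h0 : ∀ i ∈ S, f i ≠ 0)
    (h : ∀ i ∈ S, (f i).order = g) :
    (∏ i ∈ S, f i).order = S.card • g := by
  classical
  induction S using Finset.induction_on with
  | empty => simp
  | insert i S hi ih =>
    have h0' : ∀ j ∈ S, f j ≠ 0 := fun j hj => h0 j (by simp [hj])
    rw [Finset.prod_insert hi, HahnSeries.order_mul (h0 i (by simp)) (Finset.prod_ne_zero_iff.2 h0'),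
      h i (by simp), ih h0' (fun j hj => h j (by simp [hj])), Finset.card_insert_of_notMem hi,
      succ_nsmul, add_comm]

/-- embedding of Hahn series -/
noncomputable def embQ (p : ℕ) (k : Type*) [Field k] : HahnSeries (GammaP p) k →+* HahnSeries ℚ k :=
  HahnSeries.embDomainRingHom (GammaP p).subtype Subtype.val_injective (fun _ _ => Iff.rfl)

lemma embQ_single (p : ℕ) (k : Type*) [Field k] (g : GammaP p) (r : k) :
    embQ p k (HahnSeries.single g r) = HahnSeries.single (g : ℚ) r :=
  HahnSeries.embDomain_single

lemma embQ_order (p : ℕ) (k : Type*) [Field k] (f : HahnSeries (GammaP p) k) (hf : f ≠ 0) :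
    (embQ p k f).orderTop = ((f.order : ℚ) : WithTop ℚ) := by
  refine HahnSeries.orderTop_embDomain.trans ?_
  rw [← HahnSeries.order_eq_orderTop_of_ne_zero hf]
  rfl

/-- Let `p ≠ q` be primes, `k₀` a field of characteristic `p` containing a primitive `q`-th
root of unity, `Γ = ⟨1/pⁿ : n ∈ ℕ⟩ ⊆ ℚ`, `k = k₀((x^Γ))` and `F = k((t^Γ))` fields of Hahn
series, and `K = F(u)` with `u^q = t` (a cyclic extension of `F` of degree `q`). Then the
element `x` (the Hahn series `x¹` of `k`, viewed as a constant of `F`) is not a norm from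
`K`: `x ∉ N_{K/F}(K)`. -/
theorem x_not_norm_hahn
    (p q : ℕ) (hp : p.Prime) (hq : q.Prime) (hqp : q ≠ p)
    (k₀ : Type*) [Field k₀] [CharP k₀ p]
    (hroot : ∃ ζ : k₀, IsPrimitiveRoot ζ q)
    (K : Type*) [Field K]
    [Algebra (HahnSeries (GammaP p) (HahnSeries (GammaP p) k₀)) K]
    (u : K)
    (hu : u ^ q = algebraMap (HahnSeries (GammaP p) (HahnSeries (GammaP p) k₀)) K
      (HahnSeries.single (oneGammaP p) (1 : HahnSeries (GammaP p) k₀)))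
    (hadj : Algebra.adjoin (HahnSeries (GammaP p) (HahnSeries (GammaP p) k₀)) {u} = ⊤) :
    (HahnSeries.C (HahnSeries.single (oneGammaP p) (1 : k₀))
        : HahnSeries (GammaP p) (HahnSeries (GammaP p) k₀))
      ∉ Set.range
        (Algebra.norm (HahnSeries (GammaP p) (HahnSeries (GammaP p) k₀)) :
          K → HahnSeries (GammaP p) (HahnSeries (GammaP p) k₀)) := by
  rintro ⟨y, hy⟩
  obtain ⟨ζ, hζ⟩ := hroot
  have hζ0 : ζ ≠ 0 := hζ.ne_zero hq.ne_zero
  have hq0 : (q : ℚ) ≠ 0 := by exact_mod_cast hq.ne_zero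
  set k := HahnSeries (GammaP p) k₀ with hk
  set F := HahnSeries (GammaP p) k with hF
  let z : k := HahnSeries.C ζ
  have hz0 : z ≠ 0 := HahnSeries.C_ne_zero hζ0
  have hzF : IsPrimitiveRoot (HahnSeries.C z : F) q :=
    (hζ.map_of_injective (f := (HahnSeries.C : k₀ →+* k)) HahnSeries.C_injective).map_of_injective
      (f := (HahnSeries.C : k →+* F)) HahnSeries.C_injective
  have ha : ∀ b : F, b ^ q ≠ HahnSeries.single (oneGammaP p) (1 : k) := by
    intro b hb
    have := congrArg HahnSeries.order hb
    rw [HahnSeries.order_pow, HahnSeries.order_single one_ne_zero] at this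
    exact one_not_mul p q hp hq hqp _ this
  let w : HahnSeries ℚ k := HahnSeries.single (1 / (q : ℚ)) 1
  have hw : w ^ q = embQ p k (HahnSeries.single (oneGammaP p) (1 : k)) := by
    rw [embQ_single, HahnSeries.single_pow, one_pow]
    congr 1
    simp [oneGammaP, hq0]
  obtain ⟨P, I, _, e, hcard, hN⟩ := norm_core (embQ p k) q hq _ ha _ hzF u hu hadj w hw y
  have hzE : embQ p k (HahnSeries.C z) = HahnSeries.C z := HahnSeries.embDomainRingHom_C
  rw [hy, hzE, show embQ p k (HahnSeries.C (HahnSeries.single (oneGammaP p) (1 : k₀)))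
    = HahnSeries.C (HahnSeries.single (oneGammaP p) (1 : k₀)) from
      HahnSeries.embDomainRingHom_C] at hN
  -- the monomials
  have hmono : ∀ (s : I) (j : ℕ), ((HahnSeries.C z : HahnSeries ℚ k) ^ e s * w) ^ j
      = HahnSeries.single ((j : ℚ) / q) ((z ^ e s) ^ j) := by
    intro s j
    rw [← map_pow, HahnSeries.C_apply, HahnSeries.single_mul_single, HahnSeries.single_pow]
    congr 1
    · simp [div_eq_mul_inv]
    · simp
  simp only [hmono] at hN
  let T : I → ℕ → HahnSeries ℚ k := fun s j =>
    embQ p k (P.coeff j) * HahnSeries.single ((j : ℚ) / q) ((z ^ e s) ^ j)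
  have hTorder : ∀ s j, P.coeff j ≠ 0 →
      (T s j).orderTop = ((((P.coeff j).order : ℚ) + (j : ℚ) / q : ℚ) : WithTop ℚ) := by
    intro s j hj
    rw [HahnSeries.orderTop_mul, embQ_order _ _ _ hj,
      HahnSeries.orderTop_single (pow_ne_zero _ (pow_ne_zero _ hz0))]
    rfl
  have hTz : ∀ s j, P.coeff j = 0 → T s j = 0 := by
    intro s j hj
    simp [T, hj]
  have hT0 : ∀ s j, P.coeff j ≠ 0 → T s j ≠ 0 := by
    intro s j hj h
    have := hTorder s j hj
    rw [h, HahnSeries.orderTop_zero] at this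
    exact WithTop.coe_ne_top this.symm
  classical
  have hI : Nonempty I := Fintype.card_pos_iff.1 (by rw [hcard]; exact hq.pos)
  have hx0 : (HahnSeries.C (HahnSeries.single (oneGammaP p) (1 : k₀)) : HahnSeries ℚ k) ≠ 0 :=
    HahnSeries.C_ne_zero (HahnSeries.single_ne_zero one_ne_zero)
  let S := (Finset.range q).filter fun j => P.coeff j ≠ 0
  have hS : S.Nonempty := by
    by_contra hS
    rw [Finset.not_nonempty_iff_eq_empty, Finset.filter_eq_empty_iff] at hS
    apply hx0
    rw [hN]
    obtain ⟨s⟩ := hI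
    apply Finset.prod_eq_zero (Finset.mem_univ s)
    apply Finset.sum_eq_zero
    intro j hj
    exact hTz s j (not_not.1 (hS hj))
  let v : ℕ → ℚ := fun j => ((P.coeff j).order : ℚ) + (j : ℚ) / q
  have hinj : ∀ i ∈ Finset.range q, ∀ j ∈ Finset.range q, v i = v j → i = j := by
    intro i hi j hj hv
    have h1 : (q : ℚ) * (((P.coeff i).order - (P.coeff j).order : GammaP p) : ℚ)
        = ((j - i : ℤ) : ℚ) := by
      simp only [v] at hv
      field_simp at hv
      push_cast
      linarith
    have h2 := GammaP_dvd p q hp hq hqp _ (SetLike.coe_mem _) _ h1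
    rw [Finset.mem_range] at hi hj
    have h3 := Int.eq_zero_of_abs_lt_dvd h2 (by rw [abs_lt]; constructor <;> omega)
    omega
  obtain ⟨j, hjS, hmin⟩ := S.exists_min_image v hS
  obtain ⟨hjr, hj0⟩ := Finset.mem_filter.1 hjS
  have hlc : ∀ s, (∑ i ∈ Finset.range q, T s i).leadingCoeff
      = (embQ p k (P.coeff j)).leadingCoeff * (z ^ e s) ^ j := by
    intro s
    rw [leadingCoeff_sum_dominant _ _ j hjr (hT0 s j hj0), HahnSeries.leadingCoeff_mul,
      HahnSeries.leadingCoeff_of_single]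
    intro i hi hij
    by_cases hi0 : P.coeff i = 0
    · rw [hTz s i hi0, HahnSeries.orderTop_zero]
      exact HahnSeries.orderTop_lt_top.2 (hT0 s j hj0)
    · rw [hTorder s i hi0, hTorder s j hj0, WithTop.coe_lt_coe]
      exact lt_of_le_of_ne (hmin i (Finset.mem_filter.2 ⟨hi, hi0⟩))
        fun h => hij (hinj i hi j hjr h.symm)
  have hlcN := congrArg HahnSeries.leadingCoeff hN
  rw [leadingCoeff_prod, HahnSeries.C_apply, HahnSeries.leadingCoeff_of_single] at hlcN
  have hc0 : (embQ p k (P.coeff j)).leadingCoeff ≠ 0 := by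
    rw [HahnSeries.leadingCoeff_ne_zero]
    exact (map_ne_zero _).2 hj0
  have hfin := congrArg HahnSeries.order hlcN
  rw [order_prod_const _ _ ((embQ p k (P.coeff j)).leadingCoeff.order),
    HahnSeries.order_single one_ne_zero, Finset.card_univ, hcard] at hfin
  · exact one_not_mul p q hp hq hqp _ hfin.symm
  · intro s _
    rw [hlc s]
    exact mul_ne_zero hc0 (pow_ne_zero _ (pow_ne_zero _ hz0))
  · intro s _
    rw [hlc s, HahnSeries.order_mul hc0 (pow_ne_zero _ (pow_ne_zero _ hz0)), HahnSeries.order_pow,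
      HahnSeries.order_pow, HahnSeries.order_C]
    simp
end
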